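/- Let L be a positive integer and let s₀, s₁ be integers. Define W f = p_{−s₁} · 𝓕⁻¹( p_{s₀} · 𝓕 f ) on functions f : ℤ_L → ℂ, where p_c(l) = exp(πi·c·val(l)²·(L+1)/L), (𝓕f)(k) = Σ_{l ∈ ℤ_L} f(l)·exp(−2πi·val(l)·val(k)/L), and (𝓕⁻¹h)(l) = (1/L)·Σ_{k ∈ ℤ_L} h(k)·exp(2πi·val(l)·val(k)/L). Let Λ be a subgroup of (ℤ_L)² and let Λ̃ = { (x − s₀·ω, ω − s₁·(x − s₀·ω)) : (x, ω) ∈ Λ } (arithmetic in ℤ_L). Then for all f, g : ℤ_L → ℂ, W(S_{g,Λ} f) = S_{Wg, Λ̃}(W f), where S_{g,Λ} f = Σ_{z ∈ Λ} ⟨f, π(z) g⟩ · π(z) g is the Gabor frame operator. -/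

import Mathlib

open Complex

noncomputable def Tr (L : ℕ) (x : ℤ) (f : ZMod L → ℂ) : ZMod L → ℂ :=
  fun l => f (l - (x : ZMod L))

/-- Modulation operator `(M_ω f)(l) = exp(2πi·val(l)·ω/L)·f(l)` for an integer `ω`. -/
noncomputable def Md (L : ℕ) (ω : ℤ) (f : ZMod L → ℂ) : ZMod L → ℂ :=
  fun l => Complex.exp (2 * Real.pi * Complex.I * (l.val : ℂ) * (ω : ℂ) / (L : ℂ)) * f l

/-- The discrete chirp `p_c(l) = exp(πi·c·val(l)²·(L+1)/L)`. -/
noncomputable def chirp (L : ℕ) (c : ℤ) : ZMod L → ℂ :=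
  fun l => Complex.exp (Real.pi * Complex.I * (c : ℂ) * (l.val : ℂ) ^ 2 *
    ((L : ℂ) + 1) / (L : ℂ))

/-- Discrete Fourier transform `(𝓕f)(k) = Σ_l f(l)·exp(−2πi·val(l)·val(k)/L)`. -/
noncomputable def dft (L : ℕ) [NeZero L] (f : ZMod L → ℂ) : ZMod L → ℂ :=
  fun k => ∑ l : ZMod L,
    f l * Complex.exp (-(2 * Real.pi * Complex.I * (l.val : ℂ) * (k.val : ℂ)) / (L : ℂ))

/-- Inverse discrete Fourier transform
`(𝓕⁻¹h)(l) = (1/L)·Σ_k h(k)·exp(2πi·val(l)·val(k)/L)`. -/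
noncomputable def idft (L : ℕ) [NeZero L] (h : ZMod L → ℂ) : ZMod L → ℂ :=
  fun l => (1 / (L : ℂ)) * ∑ k : ZMod L,
    h k * Complex.exp (2 * Real.pi * Complex.I * (l.val : ℂ) * (k.val : ℂ) / (L : ℂ))

/-- The shear operator `W f = p_{−s₁} · 𝓕⁻¹( p_{s₀} · 𝓕 f )`. -/
noncomputable def shearOp (L : ℕ) [NeZero L] (s₀ s₁ : ℤ) (f : ZMod L → ℂ) : ZMod L → ℂ :=
  fun l => chirp L (-s₁) l * idft L (fun k => chirp L s₀ k * dft L f k) l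

/-- Translation operator for `x : ℤ_L`. -/
noncomputable def TrZ (L : ℕ) (x : ZMod L) (f : ZMod L → ℂ) : ZMod L → ℂ :=
  fun l => f (l - x)

/-- Modulation operator `(M_ω f)(l) = exp(2πi·val(l)·val(ω)/L)·f(l)` for `ω : ℤ_L`. -/
noncomputable def MdZ (L : ℕ) (ω : ZMod L) (f : ZMod L → ℂ) : ZMod L → ℂ :=
  fun l => Complex.exp (2 * Real.pi * Complex.I * (l.val : ℂ) * (ω.val : ℂ) / (L : ℂ)) * f l

/-- Time-frequency shift `π(x, ω) = M_ω T_x`. -/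
noncomputable def tfShift (L : ℕ) (z : ZMod L × ZMod L) (f : ZMod L → ℂ) : ZMod L → ℂ :=
  MdZ L z.2 (TrZ L z.1 f)

/-- Inner product `⟨f, g⟩ = Σ_l f(l)·conj(g(l))`. -/
noncomputable def ip (L : ℕ) [NeZero L] (f g : ZMod L → ℂ) : ℂ :=
  ∑ l : ZMod L, f l * (starRingEnd ℂ) (g l)

/-- Gabor frame operator `S_{g,Λ} f = Σ_{z ∈ Λ} ⟨f, π(z)g⟩ π(z)g`. -/
noncomputable def frameOp (L : ℕ) [NeZero L] (g : ZMod L → ℂ) (Λ : Set (ZMod L × ZMod L))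
    (f : ZMod L → ℂ) : ZMod L → ℂ :=
  ∑ z ∈ (Set.toFinite Λ).toFinset, ip L f (tfShift L z g) • tfShift L z g

open ZMod (stdAddChar)

lemma exp_val_mul_val (L : ℕ) [NeZero L] (l k : ZMod L) :
    Complex.exp (2 * Real.pi * Complex.I * (l.val : ℂ) * (k.val : ℂ) / (L : ℂ)) =
      stdAddChar (l * k) := by
  have h := ZMod.stdAddChar_coe (N := L) ((l.val : ℤ) * (k.val : ℤ))
  push_cast at h
  rw [ZMod.natCast_zmod_val, ZMod.natCast_zmod_val] at h
  rw [h]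
  congr 1
  ring

lemma exp_neg_val_mul_val (L : ℕ) [NeZero L] (l k : ZMod L) :
    Complex.exp (-(2 * Real.pi * Complex.I * (l.val : ℂ) * (k.val : ℂ)) / (L : ℂ)) =
      stdAddChar (-(l * k)) := by
  rw [AddChar.map_neg_eq_inv, ← exp_val_mul_val, ← Complex.exp_neg, neg_div]

lemma conj_stdAddChar (L : ℕ) [NeZero L] (a : ZMod L) :
    (starRingEnd ℂ) (stdAddChar a) = stdAddChar (-a) :=
  (AddChar.map_neg_eq_conj _ _).symm

lemma dft_eq (L : ℕ) [NeZero L] (f : ZMod L → ℂ) (k : ZMod L) :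
    dft L f k = ∑ l, f l * stdAddChar (-(l * k)) := by
  simp only [dft, exp_neg_val_mul_val]

lemma idft_eq (L : ℕ) [NeZero L] (h : ZMod L → ℂ) (l : ZMod L) :
    idft L h l = (1 / (L : ℂ)) * ∑ k, h k * stdAddChar (l * k) := by
  simp only [idft, exp_val_mul_val]

lemma tfShift_eq (L : ℕ) [NeZero L] (z : ZMod L × ZMod L) (f : ZMod L → ℂ) (l : ZMod L) :
    tfShift L z f l = stdAddChar (l * z.2) * f (l - z.1) := by
  simp only [tfShift, MdZ, TrZ, exp_val_mul_val]

lemma chirp_intCast (L : ℕ) [NeZero L] (c n : ℤ) :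
    chirp L c (n : ZMod L) =
      Complex.exp (Real.pi * Complex.I * (c : ℂ) * (n : ℂ) ^ 2 * ((L : ℂ) + 1) / (L : ℂ)) := by
  have hL : (L : ℂ) ≠ 0 := NeZero.ne _
  obtain ⟨t, ht⟩ : (L : ℤ) ∣ n - ((n : ZMod L).val : ℤ) := by
    rw [← ZMod.intCast_zmod_eq_zero_iff_dvd]
    push_cast
    rw [ZMod.natCast_zmod_val, sub_self]
  obtain ⟨u, hu⟩ : (2 : ℤ) ∣ (L : ℤ) * (L + 1) := (Int.even_mul_succ_self L).two_dvd
  set v := (n : ZMod L).val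
  have hn : (n : ℂ) = v + L * t := by
    rw [sub_eq_iff_eq_add'] at ht
    exact_mod_cast ht
  have hu' : (L : ℂ) * (L + 1) = 2 * u := by exact_mod_cast hu
  rw [chirp, Complex.exp_eq_exp_iff_exists_int]
  refine ⟨-(c * (v * t * (L + 1) + u * t ^ 2)), ?_⟩
  rw [hn]
  push_cast
  field_simp
  linear_combination (-(c : ℂ) * L * t ^ 2) * hu'

lemma chirp_add (L : ℕ) [NeZero L] (c : ℤ) (a b : ZMod L) :
    chirp L c (a + b) = chirp L c a * chirp L c b * stdAddChar ((c : ZMod L) * a * b) := by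
  have hL : (L : ℂ) ≠ 0 := NeZero.ne _
  obtain ⟨m, rfl⟩ := ZMod.intCast_surjective a
  obtain ⟨n, rfl⟩ := ZMod.intCast_surjective b
  have h := ZMod.stdAddChar_coe (N := L) (c * m * n)
  push_cast at h
  rw [h, ← Int.cast_add, chirp_intCast, chirp_intCast, chirp_intCast, ← Complex.exp_add,
    ← Complex.exp_add, Complex.exp_eq_exp_iff_exists_int]
  refine ⟨c * m * n, ?_⟩
  push_cast
  field_simp
  ring

lemma chirp_mul_conj (L : ℕ) [NeZero L] (c : ℤ) (a : ZMod L) :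
    chirp L c a * (starRingEnd ℂ) (chirp L c a) = 1 := by
  rw [chirp, ← Complex.exp_conj, ← Complex.exp_add]
  simp only [map_div₀, map_mul, map_pow, map_add, map_one, Complex.conj_ofReal, Complex.conj_I,
    Complex.conj_natCast, map_intCast]
  rw [← Complex.exp_zero]
  congr 1
  ring

lemma stdAddChar_mul_conj (L : ℕ) [NeZero L] (a : ZMod L) :
    stdAddChar a * (starRingEnd ℂ) (stdAddChar a) = 1 := by
  rw [conj_stdAddChar, ← AddChar.map_add_eq_mul, add_neg_cancel, AddChar.map_zero_eq_one]

lemma dft_tfShift (L : ℕ) [NeZero L] (z : ZMod L × ZMod L) (f : ZMod L → ℂ) (k : ZMod L) :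
    dft L (tfShift L z f) k = stdAddChar (z.1 * (z.2 - k)) * dft L f (k - z.2) := by
  rw [dft_eq, dft_eq, Finset.mul_sum, ← Equiv.sum_comp (Equiv.addRight z.1)]
  refine Finset.sum_congr rfl fun l _ => ?_
  have h : (stdAddChar ((l + z.1) * z.2) * stdAddChar (-((l + z.1) * k)) : ℂ) =
      stdAddChar (z.1 * (z.2 - k)) * stdAddChar (-(l * (k - z.2))) := by
    rw [← AddChar.map_add_eq_mul, ← AddChar.map_add_eq_mul]
    congr 1
    ring
  rw [tfShift_eq, Equiv.coe_addRight, add_sub_cancel_right]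
  linear_combination f l * h

lemma idft_modulate_translate (L : ℕ) [NeZero L] (y ω : ZMod L) (h : ZMod L → ℂ) (l : ZMod L) :
    idft L (fun k => stdAddChar (-(y * (k - ω))) * h (k - ω)) l =
      stdAddChar (l * ω) * idft L h (l - y) := by
  rw [idft_eq, idft_eq, mul_left_comm, ← Equiv.sum_comp (Equiv.addRight ω),
    Finset.mul_sum (a := stdAddChar (l * ω))]
  congr 1
  refine Finset.sum_congr rfl fun k _ => ?_
  have e : (stdAddChar (-(y * k)) * stdAddChar (l * (k + ω)) : ℂ) =
      stdAddChar (l * ω) * stdAddChar ((l - y) * k) := by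
    rw [← AddChar.map_add_eq_mul, ← AddChar.map_add_eq_mul]
    congr 1
    ring
  simp only [Equiv.coe_addRight, add_sub_cancel_right]
  linear_combination h k * e

lemma idft_smul (L : ℕ) [NeZero L] (c : ℂ) (h : ZMod L → ℂ) (l : ZMod L) :
    idft L (fun k => c * h k) l = c * idft L h l := by
  rw [idft_eq, idft_eq, mul_left_comm, Finset.mul_sum (a := c)]
  simp only [mul_assoc]

/-- The shear operator intertwines time-frequency shifts up to a unimodular factor. -/
lemma shearOp_tfShift (L : ℕ) [NeZero L] (s₀ s₁ : ℤ) (z : ZMod L × ZMod L) :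
    ∃ c : ℂ, c * (starRingEnd ℂ) c = 1 ∧ ∀ f : ZMod L → ℂ,
      shearOp L s₀ s₁ (tfShift L z f) =
        c • tfShift L (z.1 - (s₀ : ZMod L) * z.2,
          z.2 - (s₁ : ZMod L) * (z.1 - (s₀ : ZMod L) * z.2)) (shearOp L s₀ s₁ f) := by
  obtain ⟨x, ω⟩ := z
  set y := x - (s₀ : ZMod L) * ω with hy
  refine ⟨chirp L s₀ ω * chirp L (-s₁) y * stdAddChar ((s₁ : ZMod L) * y * y), ?_, fun f => ?_⟩
  · simp only [map_mul]
    linear_combination (chirp L (-s₁) y * (starRingEnd ℂ) (chirp L (-s₁) y)) *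
        (stdAddChar ((s₁ : ZMod L) * y * y) *
          (starRingEnd ℂ) (stdAddChar ((s₁ : ZMod L) * y * y))) * chirp_mul_conj L s₀ ω +
      (stdAddChar ((s₁ : ZMod L) * y * y) *
          (starRingEnd ℂ) (stdAddChar ((s₁ : ZMod L) * y * y))) * chirp_mul_conj L (-s₁) y +
      stdAddChar_mul_conj L ((s₁ : ZMod L) * y * y)
  funext l
  have hq : (fun k => chirp L s₀ k * dft L (tfShift L (x, ω) f) k) = fun k =>
      chirp L s₀ ω * (stdAddChar (-(y * (k - ω))) *
        (chirp L s₀ (k - ω) * dft L f (k - ω))) := by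
    funext k
    have h1 := chirp_add L s₀ (k - ω) ω
    rw [sub_add_cancel] at h1
    have h2 : (stdAddChar ((s₀ : ZMod L) * (k - ω) * ω) * stdAddChar (x * (ω - k)) : ℂ) =
        stdAddChar (-(y * (k - ω))) := by
      rw [← AddChar.map_add_eq_mul, hy]
      congr 1
      ring
    rw [dft_tfShift, h1]
    linear_combination chirp L s₀ (k - ω) * chirp L s₀ ω * dft L f (k - ω) * h2
  have h1 := chirp_add L (-s₁) (l - y) y
  rw [sub_add_cancel] at h1
  have h2 : (stdAddChar (((-s₁ : ℤ) : ZMod L) * (l - y) * y) * stdAddChar (l * ω) : ℂ) =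
      stdAddChar ((s₁ : ZMod L) * y * y) * stdAddChar (l * (ω - (s₁ : ZMod L) * y)) := by
    rw [← AddChar.map_add_eq_mul, ← AddChar.map_add_eq_mul]
    congr 1
    push_cast
    ring
  rw [Pi.smul_apply, smul_eq_mul, tfShift_eq, shearOp, hq, idft_smul,
    idft_modulate_translate L y ω (fun k => chirp L s₀ k * dft L f k), h1, shearOp]
  linear_combination chirp L (-s₁) (l - y) * chirp L (-s₁) y * chirp L s₀ ω *
    idft L (fun k => chirp L s₀ k * dft L f k) (l - y) * h2

lemma ip_dft (L : ℕ) [NeZero L] (f g : ZMod L → ℂ) :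
    ip L (dft L f) (dft L g) = L * ip L f g := by
  have key (l m : ZMod L) :
      ∑ k : ZMod L, (stdAddChar (-(l * k)) * stdAddChar (m * k) : ℂ) = if l = m then (L : ℂ) else 0 := by
    have h := AddChar.sum_mulShift (m - l) (ZMod.isPrimitive_stdAddChar L)
    simp only [ZMod.card, sub_eq_zero] at h
    rw [← Finset.sum_congr rfl fun k _ => AddChar.map_add_eq_mul _ (-(l * k)) (m * k)]
    convert h using 1
    · refine Finset.sum_congr rfl fun k _ => ?_
      congr 1
      ring
    · simp [eq_comm]
  simp only [ip, dft_eq, map_sum, map_mul, conj_stdAddChar, neg_neg, Finset.sum_mul_sum]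
  rw [Finset.sum_comm, Finset.mul_sum]
  refine Finset.sum_congr rfl fun l _ => ?_
  rw [Finset.sum_comm]
  have (m : ZMod L) : ∑ k, f l * stdAddChar (-(l * k)) * ((starRingEnd ℂ) (g m) *
      stdAddChar (m * k)) = f l * (starRingEnd ℂ) (g m) * if l = m then (L : ℂ) else 0 := by
    rw [← key, Finset.mul_sum]
    exact Finset.sum_congr rfl fun k _ => by ring
  simp only [this, mul_ite, mul_zero, Finset.sum_ite_eq, Finset.mem_univ, if_true]
  ring

lemma idft_eq_dft_neg (L : ℕ) [NeZero L] (h : ZMod L → ℂ) (l : ZMod L) :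
    idft L h l = (1 / (L : ℂ)) * dft L h (-l) := by
  simp only [idft_eq, dft_eq, mul_neg, neg_neg, mul_comm l]

lemma ip_idft (L : ℕ) [NeZero L] (f g : ZMod L → ℂ) :
    ip L (idft L f) (idft L g) = (1 / (L : ℂ)) * ip L f g := by
  have hL : (L : ℂ) ≠ 0 := NeZero.ne _
  have h : ip L (idft L f) (idft L g) = (1 / (L : ℂ)) ^ 2 * ip L (dft L f) (dft L g) := by
    simp only [ip, idft_eq_dft_neg]
    rw [← Equiv.sum_comp (Equiv.neg (ZMod L)), Finset.mul_sum]
    refine Finset.sum_congr rfl fun l _ => ?_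
    simp only [Equiv.neg_apply, neg_neg, map_mul, map_div₀, map_one, Complex.conj_natCast]
    ring
  rw [h, ip_dft]
  field_simp

lemma ip_chirp_mul (L : ℕ) [NeZero L] (c : ℤ) (f g : ZMod L → ℂ) :
    ip L (fun l => chirp L c l * f l) (fun l => chirp L c l * g l) = ip L f g := by
  refine Finset.sum_congr rfl fun l _ => ?_
  rw [map_mul]
  linear_combination f l * (starRingEnd ℂ) (g l) * chirp_mul_conj L c l

lemma ip_shearOp (L : ℕ) [NeZero L] (s₀ s₁ : ℤ) (f g : ZMod L → ℂ) :
    ip L (shearOp L s₀ s₁ f) (shearOp L s₀ s₁ g) = ip L f g := by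
  have hL : (L : ℂ) ≠ 0 := NeZero.ne _
  unfold shearOp
  rw [ip_chirp_mul, ip_idft, ip_chirp_mul, ip_dft]
  field_simp

lemma isLinearMap_shearOp (L : ℕ) [NeZero L] (s₀ s₁ : ℤ) :
    IsLinearMap ℂ (shearOp L s₀ s₁) where
  map_add f g := by
    funext l
    simp only [shearOp, idft, dft, Pi.add_apply, add_mul, mul_add, Finset.sum_add_distrib]
  map_smul c f := by
    have h : (fun k => chirp L s₀ k * dft L (c • f) k) =
        fun k => c * (chirp L s₀ k * dft L f k) := by
      funext k
      simp only [dft, Pi.smul_apply, smul_eq_mul, mul_assoc, ← Finset.mul_sum]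
      ring
    funext l
    rw [shearOp, h, idft_smul, Pi.smul_apply, smul_eq_mul, shearOp]
    ring

lemma ip_smul_right (L : ℕ) [NeZero L] (c : ℂ) (f g : ZMod L → ℂ) :
    ip L f (c • g) = (starRingEnd ℂ) c * ip L f g := by
  simp only [ip, Pi.smul_apply, smul_eq_mul, map_mul, Finset.mul_sum]
  exact Finset.sum_congr rfl fun l _ => by ring

/-- The shear operator `W` conjugates the Gabor frame operator on a
lattice `Λ` into the frame operator, with window `W g`, on the sheared lattice
`Λ̃ = {(x − s₀·ω, ω − s₁·(x − s₀·ω)) : (x, ω) ∈ Λ}`. -/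
theorem shear_frame_operator (L : ℕ) [NeZero L] (s₀ s₁ : ℤ)
    (Λ : AddSubgroup (ZMod L × ZMod L)) (f g : ZMod L → ℂ) :
    shearOp L s₀ s₁ (frameOp L g (Λ : Set (ZMod L × ZMod L)) f) =
      frameOp L (shearOp L s₀ s₁ g)
        ((fun z : ZMod L × ZMod L =>
            (z.1 - (s₀ : ZMod L) * z.2,
             z.2 - (s₁ : ZMod L) * (z.1 - (s₀ : ZMod L) * z.2))) ''
          (Λ : Set (ZMod L × ZMod L)))
        (shearOp L s₀ s₁ f) := by
  have hinj : Function.Injective (fun z : ZMod L × ZMod L =>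
      (z.1 - (s₀ : ZMod L) * z.2,
        z.2 - (s₁ : ZMod L) * (z.1 - (s₀ : ZMod L) * z.2))) := by
    rintro ⟨x, ω⟩ ⟨x', ω'⟩ h
    simp only [Prod.mk.injEq] at h
    obtain ⟨h1, h2⟩ := h
    have h3 : ω = ω' := by linear_combination h2 + (s₁ : ZMod L) * h1
    subst h3
    exact Prod.ext (by linear_combination h1) rfl
  classical
  unfold frameOp
  rw [Set.Finite.toFinset_image (hs := Set.toFinite _), Finset.sum_image hinj.injOn]
  rw [← IsLinearMap.mk'_apply (isLinearMap_shearOp L s₀ s₁), map_sum]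
  refine Finset.sum_congr rfl fun z _ => ?_
  obtain ⟨c, hc, hW⟩ := shearOp_tfShift L s₀ s₁ z
  rw [map_smul, IsLinearMap.mk'_apply, ← ip_shearOp L s₀ s₁, hW, ip_smul_right, smul_smul]
  congr 1
  linear_combination ip L (shearOp L s₀ s₁ f) (tfShift L _ (shearOp L s₀ s₁ g)) * hc
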